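/- (UBT for ASP, upper h-range.) Let P ∈ P(d,n,s) with ASP-pair (P,F), and let P' be the complex of all proper faces of P except F. Then for every 1 ≤ k ≤ ⌊d/2⌋, h_{d−k}(P') ≤ C(n−d−1+k, k) − C(s+k−1, k), where C(a,b) denotes the binomial coefficient. -/

import Mathlib

open Finset

namespace ASP

noncomputable section

/-- The dot product of two vectors in `ℝ^d`. -/
def dotp {d : ℕ} (x y : Fin d → ℝ) : ℝ := ∑ i, x i * y i

/-- `F` is a face of the polytope `P ⊆ ℝ^d`: the intersection of `P` with a supporting
hyperplane, together with the empty face and `P` itself. -/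
def IsFaceOf {d : ℕ} (P F : Set (Fin d → ℝ)) : Prop :=
  F = ∅ ∨ F = P ∨
    ∃ (b : Fin d → ℝ) (c : ℝ), b ≠ 0 ∧ (∀ x ∈ P, dotp b x ≤ c) ∧
      F = {x ∈ P | dotp b x = c}

/-- The dimension of a subset of `ℝ^d`: the dimension of its affine span. -/
def polyDim {d : ℕ} (S : Set (Fin d → ℝ)) : ℕ :=
  Module.finrank ℝ (affineSpan ℝ S).direction

/-- A polytope: the convex hull of a finite point set. -/
def IsPolytope {d : ℕ} (P : Set (Fin d → ℝ)) : Prop :=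
  ∃ V : Finset (Fin d → ℝ), P = convexHull ℝ (V : Set (Fin d → ℝ))

/-- The vertex set of a polytope: its set of extreme points. -/
def verts {d : ℕ} (P : Set (Fin d → ℝ)) : Set (Fin d → ℝ) :=
  Set.extremePoints ℝ P

/-- `fVec P i` is the number of `i`-dimensional (nonempty) faces of `P`. -/
def fVec {d : ℕ} (P : Set (Fin d → ℝ)) (i : ℕ) : ℕ :=
  {F : Set (Fin d → ℝ) | IsFaceOf P F ∧ F.Nonempty ∧ polyDim F = i}.ncard

/-- A facet of a `d`-polytope in `ℝ^d`: a `(d-1)`-dimensional face. -/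
def IsFacetOf {d : ℕ} (P F : Set (Fin d → ℝ)) : Prop :=
  IsFaceOf P F ∧ F.Nonempty ∧ polyDim F = d - 1

/-- `(P, F)` is an ASP-pair: `P` is a `d`-polytope, `F` is a facet of `P`, and every facet
of `P` other than `F` is a simplex (i.e. has exactly `d` vertices). -/
def IsASPPair {d : ℕ} (P F : Set (Fin d → ℝ)) : Prop :=
  IsPolytope P ∧ polyDim P = d ∧ IsFacetOf P F ∧
    ∀ G, IsFacetOf P G → G ≠ F → (verts G).ncard = d

/-- `P ∈ 𝒫(d,n,s)`: `P` is a `d`-polytope with `n` vertices such that `(P,F)` is an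
ASP-pair where the facet `F` has `d + s` vertices. -/
def MemASP (d n s : ℕ) (P : Set (Fin d → ℝ)) : Prop :=
  (verts P).ncard = n ∧ ∃ F, IsASPPair P F ∧ (verts F).ncard = d + s

/-- `fBall P i` is `f_{i-1}(P')` of the simplicial ball `P' = ∂P - {F}` consisting of all
proper faces of `P` except its (unique non-simplex) facet `F`; the index is shifted by one,
so `fBall P 0 = f_{-1} = 1` counts the empty face, and at the top dimension the facet `F`
is discarded. -/
def fBall {d : ℕ} (P : Set (Fin d → ℝ)) (i : ℕ) : ℤ :=
  if i = 0 then 1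
  else if i = d then (fVec P (d - 1) : ℤ) - 1
  else if d < i then 0
  else (fVec P (i - 1) : ℤ)

/-- `hBall P k` is `h_k(P')` of the `(d-1)`-dimensional ball `P' = ∂P - {F}`, defined by
`h_k = ∑_{i=0}^{k} (-1)^{k-i} C(d-i, k-i) f_{i-1}(P')`, extended by `0` outside `0 ≤ k ≤ d`. -/
def hBall {d : ℕ} (P : Set (Fin d → ℝ)) (k : ℤ) : ℤ :=
  if 0 ≤ k ∧ k ≤ (d : ℤ) then
    ∑ i ∈ Finset.range (k.toNat + 1),
      (-1) ^ (k.toNat - i) * ((d - i).choose (k.toNat - i) : ℤ) * fBall P i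
  else 0

/-- `fBd m Q i` is `f_{i-1}(∂Q)` of the boundary complex of an `m`-polytope `Q ⊆ ℝ^d`
(a complex of dimension `m - 1`); the index is shifted by one. -/
def fBd {d : ℕ} (m : ℕ) (Q : Set (Fin d → ℝ)) (i : ℕ) : ℤ :=
  if i = 0 then 1 else if m + 1 ≤ i then 0 else (fVec Q (i - 1) : ℤ)

/-- `hBd m Q k` is `h_k(∂Q)` for the boundary complex of an `m`-polytope `Q ⊆ ℝ^d`, defined by
`h_k = ∑_{i=0}^{k} (-1)^{k-i} C(m-i, k-i) f_{i-1}(∂Q)`, extended by `0` outside `0 ≤ k ≤ m`. -/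
def hBd {d : ℕ} (m : ℕ) (Q : Set (Fin d → ℝ)) (k : ℤ) : ℤ :=
  if 0 ≤ k ∧ k ≤ (m : ℤ) then
    ∑ i ∈ Finset.range (k.toNat + 1),
      (-1) ^ (k.toNat - i) * ((m - i).choose (k.toNat - i) : ℤ) * fBd m Q i
  else 0

/-- `gBd m Q k = g_k(∂Q) = h_k(∂Q) - h_{k-1}(∂Q)`. -/
def gBd {d : ℕ} (m : ℕ) (Q : Set (Fin d → ℝ)) (k : ℤ) : ℤ :=
  hBd m Q k - hBd m Q (k - 1)

/-- The function `p(t) = (n-1)^{(t-1)(d-1)} · t(t+1)⋯(t+d+s-1)` (real exponentiation of the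
positive base `n-1`) used to define the almost cyclic polytope. -/
def acp (d n s : ℕ) (t : ℝ) : ℝ :=
  ((n : ℝ) - 1) ^ ((t - 1) * ((d : ℝ) - 1)) * ∏ l ∈ Finset.range (d + s), (t + l)

/-- The curve `y(t) = (t, t², …, t^{d-1}, p(t)) ∈ ℝ^d`. -/
def acy (d n s : ℕ) (t : ℝ) : Fin d → ℝ :=
  fun i => if (i : ℕ) + 1 = d then acp d n s t else t ^ ((i : ℕ) + 1)

/-- The parameter values `t_i = -s - d + i` for `i = 1, …, n` (here `0`-indexed:
`acT d s j = t_{j+1}`). -/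
def acT (d s j : ℕ) : ℝ := (j : ℝ) + 1 - s - d

/-- The `n` points `y(t_1), …, y(t_n)` on the curve `y` (`0`-indexed). -/
def acPoint (d n s : ℕ) (j : Fin n) : Fin d → ℝ := acy d n s (acT d s (j : ℕ))

/-- The almost cyclic polytope `C(d,n,s) = conv{y(t_1), …, y(t_n)}`. -/
def acPolytope (d n s : ℕ) : Set (Fin d → ℝ) :=
  convexHull ℝ (Set.range (acPoint d n s))

/-- The non-simplex facet `F = conv{y(t_1), …, y(t_{d+s})}` of the almost cyclic polytope. -/
def acFacet (d n s : ℕ) : Set (Fin d → ℝ) :=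
  convexHull ℝ (acPoint d n s '' {j : Fin n | (j : ℕ) < d + s})

/-- The generalized moment curve
`x(t) = (t, t², …, t^{d-r}, p_1(t), …, p_r(t)) ∈ ℝ^d`. -/
def gmc (d r : ℕ) (p : Fin r → ℝ → ℝ) (t : ℝ) : Fin d → ℝ :=
  fun i =>
    if h : (i : ℕ) < d - r then t ^ ((i : ℕ) + 1)
    else p ⟨(i : ℕ) - (d - r), by have h2 := i.2; omega⟩ t

/-- A polytope is `k`-neighborly if each subset of at most `k` of its vertices is the
vertex set of a face. -/
def IsNeighborly {d : ℕ} (k : ℕ) (P : Set (Fin d → ℝ)) : Prop :=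
  ∀ S : Finset (Fin d → ℝ), (S : Set (Fin d → ℝ)) ⊆ verts P → S.card ≤ k →
    ∃ G : Set (Fin d → ℝ), IsFaceOf P G ∧ verts G = (S : Set (Fin d → ℝ))

/-- The point `y` is beyond the facet `F` of the polytope `P`: for every supporting
hyperplane of `P` cutting out a facet, `y` is strictly on the outer side if the facet is `F`,
and strictly on the inner side otherwise. -/
def IsBeyond {d : ℕ} (P F : Set (Fin d → ℝ)) (y : Fin d → ℝ) : Prop :=
  ∀ (b : Fin d → ℝ) (c : ℝ), b ≠ 0 → (∀ x ∈ P, dotp b x ≤ c) →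
    IsFacetOf P {x ∈ P | dotp b x = c} →
      (({x ∈ P | dotp b x = c} = F → c < dotp b y) ∧
       ({x ∈ P | dotp b x = c} ≠ F → dotp b y < c))

set_option linter.unusedSectionVars false

section Core

open Module

variable {E : Type*} [AddCommGroup E] [Module ℝ E] [FiniteDimensional ℝ E]
  {ι : Type*} [Fintype ι] [DecidableEq ι]

def Val (x : ι → E) (a : Dual ℝ E) : Prop := ∀ i, a (x i) ≤ 1

def Wt (x : ι → E) (a : Dual ℝ E) : Finset ι := univ.filter (fun i => a (x i) = 1)

lemma mem_Wt {x : ι → E} {a : Dual ℝ E} {i : ι} : i ∈ Wt x a ↔ a (x i) = 1 := by simp [Wt]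

def Spans (x : ι → E) (S : Finset ι) : Prop := Submodule.span ℝ (x '' (S : Set ι)) = ⊤

def Full (x : ι → E) : Prop := ∀ c : Dual ℝ E, c ≠ 0 → ∃ i, 0 < c (x i)

lemma pivot {x : ι → E} (hfull : Full x) {a c : Dual ℝ E} (ha : Val x a) (hc : c ≠ 0)
    (hcW : ∀ i ∈ Wt x a, c (x i) ≤ 0) :
    ∃ s : ℝ, 0 < s ∧ Val x (a + s • c) ∧ ∃ i, 0 < c (x i) ∧ (a + s • c) (x i) = 1 := by
  obtain ⟨i0, hi0⟩ := hfull c hc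
  obtain ⟨i, hi, hmin⟩ := Finset.exists_min_image (univ.filter (fun i => 0 < c (x i)))
    (fun i => (1 - a (x i)) / c (x i)) ⟨i0, by simpa using hi0⟩
  simp only [mem_filter, mem_univ, true_and] at hi hmin
  have hlt : a (x i) < 1 := by
    refine lt_of_le_of_ne (ha i) fun h => ?_
    have := hcW i (mem_Wt.2 h)
    linarith
  have hs : 0 < (1 - a (x i)) / c (x i) := div_pos (by linarith) hi
  refine ⟨_, hs, fun j => ?_, i, hi, ?_⟩
  · simp only [LinearMap.add_apply, LinearMap.smul_apply, smul_eq_mul]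
    rcases le_or_gt (c (x j)) 0 with h | h
    · have := ha j
      nlinarith [mul_nonneg hs.le (neg_nonneg.2 h)]
    · have := hmin j h
      rw [le_div_iff₀ h] at this
      linarith
  · simp only [LinearMap.add_apply, LinearMap.smul_apply, smul_eq_mul]
    field_simp
    ring

lemma eq_of_spans {x : ι → E} {S : Finset ι} (hS : Spans x S) {a b : Dual ℝ E}
    (h : ∀ i ∈ S, a (x i) = b (x i)) : a = b := by
  apply LinearMap.ext_on (s := x '' (S : Set ι)) hS
  rintro _ ⟨i, hi, rfl⟩
  exact h i hi

lemma spans_mono {x : ι → E} {S T : Finset ι} (hS : Spans x S) (h : S ⊆ T) : Spans x T := by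
  unfold Spans at *
  rw [eq_top_iff, ← hS]
  exact Submodule.span_mono (Set.image_mono (by exact_mod_cast h))

lemma exists_facet {x : ι → E} (hfull : Full x) {b : Dual ℝ E} (hb : Val x b) (u : E) :
    ∃ a, Val x a ∧ Wt x b ⊆ Wt x a ∧ Spans x (Wt x a) ∧ b u ≤ a u := by
  by_contra hcon
  push Not at hcon
  have key : ∀ m : ℕ, ∃ a, Val x a ∧ Wt x b ⊆ Wt x a ∧ b u ≤ a u ∧ m ≤ (Wt x a).card := by
    intro m
    induction m with
    | zero => exact ⟨b, hb, Subset.rfl, le_rfl, Nat.zero_le _⟩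
    | succ m ih =>
      obtain ⟨a, ha, hsub, hu, hm⟩ := ih
      have hns : ¬ Spans x (Wt x a) := fun h => absurd (hcon a ha hsub h) (not_lt.2 hu)
      obtain ⟨c0, hc0, hk⟩ := Submodule.exists_le_ker_of_lt_top _ (lt_top_iff_ne_top.2 hns)
      obtain ⟨c, hc, hker, hcu⟩ : ∃ c : Dual ℝ E, c ≠ 0 ∧ (∀ i ∈ Wt x a, c (x i) = 0) ∧ 0 ≤ c u := by
        have h0 : ∀ i ∈ Wt x a, c0 (x i) = 0 := fun i hi =>
          hk (Submodule.subset_span ⟨i, hi, rfl⟩)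
        rcases le_total 0 (c0 u) with h | h
        · exact ⟨c0, hc0, h0, h⟩
        · exact ⟨-c0, neg_ne_zero.2 hc0, fun i hi => by simp [h0 i hi], by simpa using h⟩
      obtain ⟨s, hs, hval, i, hi, hi1⟩ := pivot hfull ha hc (fun i hi => (hker i hi).le)
      have hss : insert i (Wt x a) ⊆ Wt x (a + s • c) := by
        intro j hj
        rcases Finset.mem_insert.1 hj with rfl | hj
        · exact mem_Wt.2 hi1
        · rw [mem_Wt]; simp [hker j hj, mem_Wt.1 hj]
      have hni : i ∉ Wt x a := fun h => by rw [hker i h] at hi; exact lt_irrefl _ hi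
      refine ⟨_, hval, hsub.trans ((Finset.subset_insert _ _).trans hss), ?_, ?_⟩
      · simp only [LinearMap.add_apply, LinearMap.smul_apply, smul_eq_mul]
        nlinarith [mul_nonneg hs.le hcu]
      · have := Finset.card_le_card hss
        rw [Finset.card_insert_of_notMem hni] at this
        omega
  obtain ⟨a, -, -, -, h⟩ := key (Fintype.card ι + 1)
  have := Finset.card_le_univ (Wt x a)
  omega

structure Cfg (E : Type*) [AddCommGroup E] [Module ℝ E] [FiniteDimensional ℝ E]
    (ι : Type*) [Fintype ι] [DecidableEq ι] where
  x : ι → E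
  full : Full x
  aF : Dual ℝ E
  valF : Val x aF
  spanF : Spans x (Wt x aF)
  simpl : ∀ a, Val x a → Spans x (Wt x a) → a ≠ aF → (Wt x a).card = finrank ℝ E

namespace Cfg

variable (C : Cfg E ι)

def WF : Finset ι := Wt C.x C.aF

open Classical in
def J : Finset (Finset ι) :=
  univ.filter (fun S => ∃ a, Val C.x a ∧ Spans C.x (Wt C.x a) ∧ a ≠ C.aF ∧ Wt C.x a = S)

lemma mem_J {S : Finset ι} : S ∈ C.J ↔
    ∃ a, Val C.x a ∧ Spans C.x (Wt C.x a) ∧ a ≠ C.aF ∧ Wt C.x a = S := by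
  simp [J]

lemma card_J {S : Finset ι} (hS : S ∈ C.J) : S.card = finrank ℝ E := by
  obtain ⟨a, h1, h2, h3, rfl⟩ := C.mem_J.1 hS
  exact C.simpl a h1 h2 h3

lemma spans_J {S : Finset ι} (hS : S ∈ C.J) : Spans C.x S := by
  obtain ⟨a, h1, h2, h3, rfl⟩ := C.mem_J.1 hS
  exact h2

lemma linInd_J {S : Finset ι} (hS : S ∈ C.J) :
    LinearIndependent ℝ (fun i : S => C.x i) := by
  apply linearIndependent_of_top_le_span_of_card_eq_finrank
  · have := C.spans_J hS
    unfold Spans at this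
    rw [← this]
    apply Submodule.span_mono
    rintro _ ⟨i, hi, rfl⟩
    exact ⟨⟨i, hi⟩, rfl⟩
  · simpa using C.card_J hS

lemma exists_co {S : Finset ι} (hS : S ∈ C.J) : ∃ c : ι → Dual ℝ E,
    (∀ i ∈ S, ∀ j ∈ S, c i (C.x j) = if i = j then 1 else 0) ∧
    ∀ u, u = ∑ i ∈ S, c i u • C.x i := by
  have hli := C.linInd_J hS
  have hsp : ⊤ ≤ Submodule.span ℝ (Set.range (fun i : S => C.x i)) := by
    have := C.spans_J hS
    unfold Spans at this
    rw [← this]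
    apply Submodule.span_mono
    rintro _ ⟨i, hi, rfl⟩
    exact ⟨⟨i, hi⟩, rfl⟩
  let b := Basis.mk hli hsp
  refine ⟨fun i => if h : i ∈ S then b.coord ⟨i, h⟩ else 0, ?_, ?_⟩
  · intro i hi j hj
    have hb : C.x j = b ⟨j, hj⟩ := by simp [b]
    simp only [hi, dif_pos]
    rw [hb, Basis.coord_apply, Basis.repr_self, Finsupp.single_apply]
    simp [eq_comm]
  · intro u
    conv_lhs => rw [← b.sum_repr u]
    rw [← Finset.sum_coe_sort S]
    apply Finset.sum_congr rfl
    intro i _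
    simp [b]

def co (S : Finset ι) (i : ι) : Dual ℝ E :=
  open Classical in if h : S ∈ C.J then (C.exists_co h).choose i else 0

lemma co_apply {S : Finset ι} (hS : S ∈ C.J) {i j : ι} (hi : i ∈ S) (hj : j ∈ S) :
    C.co S i (C.x j) = if i = j then 1 else 0 := by
  simp only [co, hS, dif_pos]
  exact (C.exists_co hS).choose_spec.1 i hi j hj

lemma co_sum {S : Finset ι} (hS : S ∈ C.J) (u : E) :
    u = ∑ i ∈ S, C.co S i u • C.x i := by
  simp only [co, hS, dif_pos]
  exact (C.exists_co hS).choose_spec.2 u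

def R (S : Finset ι) (u : E) : Finset ι := S.filter (fun i => C.co S i u < 0)

def Gen (u : E) : Prop := ∀ S ∈ C.J, ∀ i ∈ S, C.co S i u ≠ 0

def InF (u : E) : Prop := ∀ b, Val C.x b → b ≠ C.aF → b u < C.aF u

lemma comp {u : E} (hu : C.Gen u) {S G : Finset ι} (hS : S ∈ C.J) {a b : Dual ℝ E}
    (haS : Wt C.x a = S) (hR : C.R S u ⊆ G) (hb : Val C.x b)
    (hGb : G ⊆ Wt C.x b) : b u ≤ a u ∧ (b u = a u → S ⊆ Wt C.x b) := by
  have ea : a u = ∑ i ∈ S, C.co S i u := by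
    conv_lhs => rw [C.co_sum hS u]
    rw [map_sum]
    refine Finset.sum_congr rfl fun i hi => ?_
    rw [← haS] at hi
    simp [mem_Wt.1 hi, haS]
  have eb : b u = ∑ i ∈ S, C.co S i u * b (C.x i) := by
    conv_lhs => rw [C.co_sum hS u]
    rw [map_sum]
    refine Finset.sum_congr rfl fun i hi => ?_
    simp
  have term : ∀ i ∈ S, C.co S i u * b (C.x i) ≤ C.co S i u := by
    intro i hi
    rcases lt_or_ge (C.co S i u) 0 with h | h
    · rw [mem_Wt.1 (hGb (hR (Finset.mem_filter.2 ⟨hi, h⟩))), mul_one]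
    · exact mul_le_of_le_one_right h (hb i)
  refine ⟨by rw [ea, eb]; exact Finset.sum_le_sum term, fun h => ?_⟩
  rw [ea, eb] at h
  have := (Finset.sum_eq_sum_iff_of_le term).1 h
  intro i hi
  rw [mem_Wt]
  have h1 := this i hi
  exact mul_left_cancel₀ (hu S hS i hi) (by rw [h1, mul_one])

lemma part_unique {u : E} (hu : C.Gen u) {S S' G : Finset ι} (hS : S ∈ C.J) (hS' : S' ∈ C.J)
    (h1 : C.R S u ⊆ G) (h2 : G ⊆ S) (h1' : C.R S' u ⊆ G) (h2' : G ⊆ S') : S = S' := by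
  obtain ⟨a, ha, -, -, haS⟩ := C.mem_J.1 hS
  obtain ⟨a', ha', -, -, haS'⟩ := C.mem_J.1 hS'
  obtain ⟨p1, q1⟩ := C.comp hu hS haS h1 ha' (by rwa [haS'])
  obtain ⟨p2, q2⟩ := C.comp hu hS' haS' h1' ha (by rwa [haS])
  have e := le_antisymm p1 p2
  have r1 := q1 e
  have r2 := q2 e.symm
  rw [haS'] at r1
  rw [haS] at r2
  exact Subset.antisymm r1 r2

lemma part_exists {u : E} {G : Finset ι} {a0 : Dual ℝ E}
    (h0 : Val C.x a0) (hs0 : Spans C.x (Wt C.x a0)) (hG : G ⊆ Wt C.x a0)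
    (hF : G ⊆ C.WF → C.aF u < a0 u) : ∃ S ∈ C.J, C.R S u ⊆ G ∧ G ⊆ S := by
  classical
  let FF : Finset (Finset ι) :=
    univ.filter (fun S => ∃ a, Val C.x a ∧ Spans C.x (Wt C.x a) ∧ Wt C.x a = S ∧ G ⊆ S)
  have hFF : ∀ S, S ∈ FF ↔ ∃ a, Val C.x a ∧ Spans C.x (Wt C.x a) ∧ Wt C.x a = S ∧ G ⊆ S := by
    intro S; simp [FF]
  have : ∀ S : Finset ι, ∃ a : Dual ℝ E, S ∈ FF →
      (Val C.x a ∧ Spans C.x (Wt C.x a) ∧ Wt C.x a = S ∧ G ⊆ S) := by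
    intro S
    by_cases h : S ∈ FF
    · obtain ⟨a, ha⟩ := (hFF S).1 h
      exact ⟨a, fun _ => ha⟩
    · exact ⟨0, fun h' => absurd h' h⟩
  choose fa hfa using this
  obtain ⟨S, hS, hmax⟩ := Finset.exists_max_image FF (fun S => fa S u)
    ⟨Wt C.x a0, (hFF _).2 ⟨a0, h0, hs0, rfl, hG⟩⟩
  obtain ⟨hv, hsp, hW, hGS⟩ := hfa S hS
  have hmax' : ∀ b, Val C.x b → Spans C.x (Wt C.x b) → G ⊆ Wt C.x b → b u ≤ fa S u := by
    intro b hb hsb hGb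
    have hm : Wt C.x b ∈ FF := (hFF _).2 ⟨b, hb, hsb, rfl, hGb⟩
    have := hmax _ hm
    obtain ⟨hv', hsp', hW', -⟩ := hfa _ hm
    have e : b = fa (Wt C.x b) := by
      apply eq_of_spans hsb
      intro i hi
      rw [mem_Wt.1 hi, mem_Wt.1 (hW'.symm ▸ hi)]
    rw [e]; exact this
  have hne : fa S ≠ C.aF := by
    intro h
    have h2 : G ⊆ C.WF := by rw [WF, ← h, hW]; exact hGS
    have := hmax' a0 h0 hs0 hG
    rw [h] at this
    exact absurd (hF h2) (not_lt.2 this)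
  have hSJ : S ∈ C.J := C.mem_J.2 ⟨fa S, hv, hsp, hne, hW⟩
  refine ⟨S, hSJ, fun i hi => ?_, hGS⟩
  obtain ⟨hiS, hineg⟩ := Finset.mem_filter.1 hi
  by_contra hiG
  have hci : C.co S i (C.x i) = 1 := by simp [C.co_apply hSJ hiS hiS]
  have hc0 : (-C.co S i) ≠ 0 := by
    intro h
    have : (-C.co S i) (C.x i) = 0 := by rw [h]; rfl
    simp [hci] at this
  obtain ⟨s, hs, hval, w, hw, hw1⟩ := pivot C.full hv hc0 (by
    intro j hj
    rw [hW] at hj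
    simp only [LinearMap.neg_apply, C.co_apply hSJ hiS hj]
    split_ifs <;> norm_num)
  have hsub : insert w (S.erase i) ⊆ Wt C.x (fa S + s • (-C.co S i)) := by
    intro j hj
    rcases Finset.mem_insert.1 hj with rfl | hj
    · exact mem_Wt.2 hw1
    · obtain ⟨h1, h2⟩ := Finset.mem_erase.1 hj
      have h3 : fa S (C.x j) = 1 := mem_Wt.1 (hW.symm ▸ h2)
      rw [mem_Wt]
      simp [C.co_apply hSJ hiS h2, h3, Ne.symm h1]
  have hspan : Spans C.x (Wt C.x (fa S + s • (-C.co S i))) := by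
    refine spans_mono ?_ hsub
    unfold Spans
    set M := Submodule.span ℝ (C.x '' ((insert w (S.erase i) : Finset ι) : Set ι)) with hM
    have hxM : ∀ j ∈ insert w (S.erase i), C.x j ∈ M := fun j hj =>
      Submodule.subset_span ⟨j, hj, rfl⟩
    have hiM : C.x i ∈ M := by
      have e := C.co_sum hSJ (C.x w)
      rw [← Finset.add_sum_erase _ _ hiS] at e
      have hne : C.co S i (C.x w) ≠ 0 := by
        intro h; simp [h] at hw
      have : C.co S i (C.x w) • C.x i ∈ M := by
        rw [← sub_eq_iff_eq_add] at e
        rw [← e]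
        refine M.sub_mem (hxM _ (Finset.mem_insert_self _ _)) (M.sum_mem fun j hj => M.smul_mem _ (hxM _ (Finset.mem_insert_of_mem hj)))
      exact (M.smul_mem_iff hne).1 this
    rw [eq_top_iff, ← C.spans_J hSJ, Submodule.span_le]
    rintro _ ⟨j, hj, rfl⟩
    by_cases hji : j = i
    · rw [hji]; exact hiM
    · exact hxM j (Finset.mem_insert_of_mem (Finset.mem_erase.2 ⟨hji, hj⟩))
  have := hmax' _ hval hspan (fun j hj => hsub (Finset.mem_insert_of_mem
    (Finset.mem_erase.2 ⟨fun h => hiG (h ▸ hj), hGS hj⟩)))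
  simp only [LinearMap.add_apply, LinearMap.smul_apply, smul_eq_mul, LinearMap.neg_apply] at this
  nlinarith

end Cfg
end Core

lemma choose_inv (M k r : ℕ) (hk : k ≤ M) (hr : r ≤ M) :
    ∑ i ∈ range (k + 1), (-1 : ℤ) ^ (k - i) * ((M - i).choose (k - i) : ℤ) * ((M - r).choose (M - i) : ℤ)
      = if r = k then 1 else 0 := by
  by_cases hrk : r ≤ k
  · have : ∀ i ∈ range (k + 1), (-1 : ℤ) ^ (k - i) * ((M - i).choose (k - i) : ℤ) * ((M - r).choose (M - i) : ℤ)
        = ((M - r).choose (M - k) : ℤ) * ((-1 : ℤ) ^ (k - i) * ((k - r).choose (k - i) : ℤ)) := by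
      intro i hi
      have hi' : i ≤ k := by simpa [Nat.lt_succ_iff] using hi
      have e : (M - r).choose (M - i) * (M - i).choose (k - i)
          = (M - r).choose (M - k) * (k - r).choose (k - i) := by
        by_cases hir : r ≤ i
        · have h1 := Nat.choose_mul (n := M - r) (k := M - i) (s := M - k) (by omega)
          have h2 : (M - i).choose (k - i) = (M - i).choose (M - k) := by
            rw [← Nat.choose_symm (n := M - i) (k := M - k) (by omega)]
            congr 1; omega
          rw [h2, h1]
          congr 2 <;> omega
        · rw [Nat.choose_eq_zero_of_lt (by omega : M - r < M - i),
            Nat.choose_eq_zero_of_lt (by omega : k - r < k - i)]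
          simp
      have e' : ((M - r).choose (M - i) : ℤ) * ((M - i).choose (k - i) : ℤ)
          = ((M - r).choose (M - k) : ℤ) * ((k - r).choose (k - i) : ℤ) := by exact_mod_cast e
      linear_combination (-1 : ℤ) ^ (k - i) * e'
    rw [Finset.sum_congr rfl this, ← Finset.mul_sum]
    have h2 := Finset.sum_range_reflect (fun j => (-1 : ℤ) ^ j * ((k - r).choose j : ℤ)) (k + 1)
    simp only [Nat.add_sub_cancel] at h2
    rw [h2]
    have h3 : ∑ j ∈ range (k + 1), (-1 : ℤ) ^ j * ((k - r).choose j : ℤ)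
        = ∑ j ∈ range (k - r + 1), (-1 : ℤ) ^ j * ((k - r).choose j : ℤ) := by
      symm
      apply Finset.sum_subset
      · intro j; simp; omega
      · intro j _ hj
        rw [Nat.choose_eq_zero_of_lt (by simpa [Nat.lt_succ_iff] using hj)]
        simp
    rw [h3, Int.alternating_sum_range_choose]
    by_cases h : r = k
    · subst h; simp
    · rw [if_neg (by omega), if_neg h]; simp
  · rw [if_neg (by omega)]
    apply Finset.sum_eq_zero
    intro i hi
    have hi' : i ≤ k := by simpa [Nat.lt_succ_iff] using hi
    rw [Nat.choose_eq_zero_of_lt (by omega : M - r < M - i)]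
    simp

lemma count_inv {α : Type*} (s : Finset α) (r : α → ℕ) (M k : ℕ) (hk : k ≤ M)
    (hr : ∀ j ∈ s, r j ≤ M) :
    ((s.filter (fun j => r j = k)).card : ℤ) =
      ∑ i ∈ range (k + 1), (-1 : ℤ) ^ (k - i) * ((M - i).choose (k - i) : ℤ) *
        ((∑ j ∈ s, (M - r j).choose (M - i) : ℕ) : ℤ) := by
  push_cast
  simp_rw [Finset.mul_sum]
  rw [Finset.sum_comm, Finset.sum_congr rfl (fun j hj => choose_inv M k (r j) hk (hr j hj))]
  simp

lemma card_interval {ι : Type*} [Fintype ι] [DecidableEq ι] {A S : Finset ι} (hAS : A ⊆ S) (i : ℕ)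
    (hi : i ≤ S.card) :
    (univ.filter (fun G : Finset ι => A ⊆ G ∧ G ⊆ S ∧ G.card = i)).card
      = (S.card - A.card).choose (S.card - i) := by
  rw [← Finset.card_sdiff_of_subset hAS, ← Finset.card_powersetCard]
  apply Finset.card_bij' (fun G _ => S \ G) (fun B _ => S \ B)
  · intro G hG
    simp only [mem_filter, mem_univ, true_and] at hG
    rw [Finset.mem_powersetCard]
    refine ⟨Finset.sdiff_subset_sdiff Subset.rfl hG.1, ?_⟩
    rw [Finset.card_sdiff_of_subset hG.2.1, hG.2.2]
  · intro B hB
    rw [Finset.mem_powersetCard] at hB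
    simp only [mem_filter, mem_univ, true_and]
    have hBS : B ⊆ S := hB.1.trans Finset.sdiff_subset
    refine ⟨?_, Finset.sdiff_subset, ?_⟩
    · intro a ha
      rw [Finset.mem_sdiff]
      exact ⟨hAS ha, fun h => (Finset.mem_sdiff.1 (hB.1 h)).2 ha⟩
    · rw [Finset.card_sdiff_of_subset hBS, hB.2]; omega
  · intro G hG
    simp only [mem_filter, mem_univ, true_and] at hG
    exact Finset.sdiff_sdiff_eq_self hG.2.1
  · intro B hB
    rw [Finset.mem_powersetCard] at hB
    exact Finset.sdiff_sdiff_eq_self (hB.1.trans Finset.sdiff_subset)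

section Core

open Module

variable {E : Type*} [AddCommGroup E] [Module ℝ E] [FiniteDimensional ℝ E]
  {ι : Type*} [Fintype ι] [DecidableEq ι]

namespace Cfg

variable (C : Cfg E ι)

/-- the simplicial complex -/
def InD (G : Finset ι) : Prop := ∃ S ∈ C.J, G ⊆ S

lemma R_sub (S : Finset ι) (u : E) : C.R S u ⊆ S := Finset.filter_subset _ _

def Nn (T : Finset ι) (k : ℕ) (u : E) : ℕ :=
  (C.J.filter (fun S => T ⊆ S ∧ (C.R S u \ T).card = k)).card

/-- a class of faces that is partitioned -/
lemma count_gen {u : E} (hu : C.Gen u) (T : Finset ι) (p : Finset ι → Prop) [DecidablePred p]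
    (h1 : ∀ G, p G → T ⊆ G ∧ ∃ S ∈ C.J, C.R S u ⊆ G ∧ G ⊆ S)
    (h2 : ∀ G, ∀ S ∈ C.J, T ⊆ G → C.R S u ⊆ G → G ⊆ S → p G) (i : ℕ)
    (hi : T.card + i ≤ finrank ℝ E) :
    (univ.filter (fun G => p G ∧ G.card = T.card + i)).card =
      ∑ S ∈ C.J.filter (fun S => T ⊆ S),
        (finrank ℝ E - T.card - (C.R S u \ T).card).choose (finrank ℝ E - T.card - i) := by
  have e : univ.filter (fun G => p G ∧ G.card = T.card + i) =
      (C.J.filter (fun S => T ⊆ S)).biUnion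
        (fun S => univ.filter (fun G => T ∪ C.R S u ⊆ G ∧ G ⊆ S ∧ G.card = T.card + i)) := by
    ext G
    simp only [mem_filter, mem_univ, true_and, mem_biUnion]
    constructor
    · rintro ⟨hp, hc⟩
      obtain ⟨hT, S, hS, hR, hG⟩ := h1 G hp
      exact ⟨S, ⟨hS, hT.trans hG⟩, Finset.union_subset hT hR, hG, hc⟩
    · rintro ⟨S, ⟨hS, hT⟩, hR, hG, hc⟩
      exact ⟨h2 G S hS (Finset.union_subset_left hR) (Finset.union_subset_right hR) hG, hc⟩
  rw [e, Finset.card_biUnion]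
  · apply Finset.sum_congr rfl
    intro S hS
    obtain ⟨hS, hT⟩ := Finset.mem_filter.1 hS
    rw [card_interval (Finset.union_subset hT (C.R_sub S u)) _ (by rw [C.card_J hS]; exact hi),
      C.card_J hS]
    have : (T ∪ C.R S u).card = T.card + (C.R S u \ T).card := by
      rw [← Finset.union_sdiff_self_eq_union, Finset.card_union_of_disjoint Finset.disjoint_sdiff]
    rw [this, Nat.sub_add_eq, Nat.sub_add_eq]
  · intro S hS S' hS' hne
    change Disjoint _ _
    rw [Finset.disjoint_left]
    intro G hG hG'
    simp only [mem_filter, mem_univ, true_and] at hG hG'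
    exact hne (C.part_unique hu (Finset.mem_filter.1 hS).1 (Finset.mem_filter.1 hS').1
      (Finset.union_subset_right hG.1) hG.2.1 (Finset.union_subset_right hG'.1) hG'.2.1)

lemma card_RT_le {S T : Finset ι} (hS : S ∈ C.J) (hT : T ⊆ S) (u : E) :
    (C.R S u \ T).card ≤ finrank ℝ E - T.card := by
  rw [← C.card_J hS, ← Finset.card_sdiff_of_subset hT]
  exact Finset.card_le_card (Finset.sdiff_subset_sdiff (C.R_sub S u) Subset.rfl)

lemma Nn_eq {u : E} (hu : C.Gen u) (T : Finset ι) (p : Finset ι → Prop) [DecidablePred p]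
    (h1 : ∀ G, p G → T ⊆ G ∧ ∃ S ∈ C.J, C.R S u ⊆ G ∧ G ⊆ S)
    (h2 : ∀ G, ∀ S ∈ C.J, T ⊆ G → C.R S u ⊆ G → G ⊆ S → p G) (k : ℕ)
    (hk : T.card + k ≤ finrank ℝ E) :
    (C.Nn T k u : ℤ) = ∑ i ∈ range (k + 1), (-1 : ℤ) ^ (k - i) *
      ((finrank ℝ E - T.card - i).choose (k - i) : ℤ) *
        ((univ.filter (fun G => p G ∧ G.card = T.card + i)).card : ℤ) := by
  have := count_inv (C.J.filter (fun S => T ⊆ S)) (fun S => (C.R S u \ T).card)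
    (finrank ℝ E - T.card) k (by omega) (by
      intro S hS
      obtain ⟨hS, hT⟩ := Finset.mem_filter.1 hS
      exact C.card_RT_le hS hT u)
  rw [Finset.filter_filter] at this
  rw [Nn, this]
  apply Finset.sum_congr rfl
  intro i hi
  have hi' : i ≤ k := by simpa [Nat.lt_succ_iff] using hi
  rw [C.count_gen hu T p h1 h2 i (by omega)]

lemma R_not_sub {u : E} (hu : C.Gen u) (hF : C.InF u) {S : Finset ι} (hS : S ∈ C.J) :
    ¬ C.R S u ⊆ C.WF := by
  intro h
  obtain ⟨a, ha, hs, hne, haS⟩ := C.mem_J.1 hS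
  have := (C.comp hu hS haS Subset.rfl C.valF h).1
  exact absurd (hF a ha hne) (not_lt.2 this)

lemma Nn_int {u : E} (hu : C.Gen u) (T : Finset ι) (hT : ¬ T ⊆ C.WF ∨ C.InF u) (k : ℕ)
    (hk : T.card + k ≤ finrank ℝ E) :
    (C.Nn T k u : ℤ) = ∑ i ∈ range (k + 1), (-1 : ℤ) ^ (k - i) *
      ((finrank ℝ E - T.card - i).choose (k - i) : ℤ) *
        (open Classical in (univ.filter (fun G => (C.InD G ∧ T ⊆ G ∧ ¬ G ⊆ C.WF) ∧ G.card = T.card + i)).card : ℤ) := by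
  classical
  apply C.Nn_eq hu T (fun G => C.InD G ∧ T ⊆ G ∧ ¬ G ⊆ C.WF) _ _ k hk
  · rintro G ⟨⟨S, hS, hG⟩, hTG, hGF⟩
    obtain ⟨a, ha, hs, hne, rfl⟩ := C.mem_J.1 hS
    exact ⟨hTG, C.part_exists ha hs hG (fun h => absurd h hGF)⟩
  · intro G S hS hTG hR hG
    refine ⟨⟨S, hS, hG⟩, hTG, fun h => ?_⟩
    rcases hT with hT | hT
    · exact hT (hTG.trans h)
    · exact C.R_not_sub hu hT hS (hR.trans h)

lemma Nn_zero (T : Finset ι) (k : ℕ) (u : E) (hk : finrank ℝ E < T.card + k) :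
    C.Nn T k u = 0 := by
  rw [Nn, Finset.card_eq_zero, Finset.filter_eq_empty_iff]
  rintro S hS ⟨hT, h⟩
  have := C.card_RT_le hS hT u
  have h3 := Finset.card_le_card hT
  rw [C.card_J hS] at h3
  omega

lemma Nn_indep {u u' : E} (hu : C.Gen u) (hu' : C.Gen u') (T : Finset ι)
    (hT : ¬ T ⊆ C.WF ∨ C.InF u) (hT' : ¬ T ⊆ C.WF ∨ C.InF u') (k : ℕ) :
    C.Nn T k u = C.Nn T k u' := by
  by_cases hk : T.card + k ≤ finrank ℝ E
  · have h1 := C.Nn_int hu T hT k hk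
    rw [← C.Nn_int hu' T hT' k hk] at h1
    exact_mod_cast h1
  · rw [C.Nn_zero T k u (by omega), C.Nn_zero T k u' (by omega)]

lemma ev_ne (α β : ℝ) (hβ : β ≠ 0) : ∀ᶠ ε in nhdsWithin (0 : ℝ) (Set.Ioi 0), α + ε * β ≠ 0 := by
  by_cases hα : α = 0
  · filter_upwards [self_mem_nhdsWithin] with ε hε
    rw [hα, zero_add]
    exact mul_ne_zero (ne_of_gt hε) hβ
  · apply Filter.Eventually.filter_mono nhdsWithin_le_nhds
    have : ContinuousAt (fun ε : ℝ => α + ε * β) 0 := by fun_prop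
    exact this.eventually_ne (by simpa using hα)

lemma ev_pos (β : ℝ) : ∀ᶠ ε in nhdsWithin (0 : ℝ) (Set.Ioi 0), 0 < 1 + ε * β := by
  apply Filter.Eventually.filter_mono nhdsWithin_le_nhds
  have : ContinuousAt (fun ε : ℝ => 1 + ε * β) 0 := by fun_prop
  exact this.eventually (lt_mem_nhds (by simp))

lemma Nn_mono {u : E} (hu : C.Gen u) (T : Finset ι) {w : ι}
    (h : ¬ T ⊆ C.WF ∨ (C.InF u ∧ w ∈ C.WF)) (k : ℕ) :
    C.Nn (insert w T) k u ≤ C.Nn T k u := by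
  have hev : ∀ᶠ ε in nhdsWithin (0 : ℝ) (Set.Ioi 0), ∀ S ∈ C.J, ∀ i ∈ S,
      C.co S i (C.x w) + ε * C.co S i u ≠ 0 ∧ 0 < 1 + ε * C.co S i u := by
    rw [Filter.eventually_all_finset]
    intro S hS
    rw [Filter.eventually_all_finset]
    intro i hi
    exact (ev_ne _ _ (hu S hS i hi)).and (ev_pos _)
  obtain ⟨ε, hε, hpos⟩ := (hev.and self_mem_nhdsWithin).exists
  replace hpos : 0 < ε := hpos
  set u' := C.x w + ε • u with hu'def
  have hu' : C.Gen u' := by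
    intro S hS i hi
    have := (hε S hS i hi).1
    simpa [u'] using this
  have hwR : ∀ S ∈ C.J, w ∈ S → w ∉ C.R S u' := by
    intro S hS hwS hwR
    have h1 := (Finset.mem_filter.1 hwR).2
    have h2 := (hε S hS w hwS).2
    simp [u', C.co_apply hS hwS hwS] at h1
    linarith
  have hInF : C.InF u → w ∈ C.WF → C.InF u' := by
    intro hF hwF b hb hne
    have h1 := hF b hb hne
    have h2 : C.aF (C.x w) = 1 := mem_Wt.1 hwF
    have h3 := hb w
    simp only [u', map_add, map_smul, smul_eq_mul]
    nlinarith
  have hT' : ¬ T ⊆ C.WF ∨ C.InF u' := h.imp id (fun h => hInF h.1 h.2)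
  have hT : ¬ T ⊆ C.WF ∨ C.InF u := h.imp id (fun h => h.1)
  have hi : ∀ {v}, (¬ T ⊆ C.WF ∨ C.InF v) → (¬ insert w T ⊆ C.WF ∨ C.InF v) := fun h =>
    h.imp (fun h h' => h ((Finset.subset_insert _ _).trans h')) id
  rw [C.Nn_indep hu hu' (insert w T) (hi hT) (hi hT') k, C.Nn_indep hu hu' T hT hT' k]
  apply Finset.card_le_card
  intro S hS
  simp only [mem_filter] at hS ⊢
  obtain ⟨hS, hTS, hc⟩ := hS
  refine ⟨hS, (Finset.subset_insert _ _).trans hTS, ?_⟩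
  rw [← hc]
  congr 1
  have := hwR S hS (hTS (Finset.mem_insert_self _ _))
  ext i
  simp only [mem_sdiff, mem_insert, not_or]
  constructor
  · rintro ⟨h1, h2⟩
    exact ⟨h1, fun h => this (h ▸ h1), h2⟩
  · rintro ⟨h1, h2, h3⟩
    exact ⟨h1, h3⟩

lemma card_erase_count {A B : Finset ι} (hAB : A ⊆ B) (k : ℕ) :
    (B.filter (fun w => (A.erase w).card = k)).card + k * (if A.card = k then 1 else 0)
      = B.card * (if A.card = k then 1 else 0) + (k + 1) * (if A.card = k + 1 then 1 else 0) := by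
  have e : ∀ w, (A.erase w).card = if w ∈ A then A.card - 1 else A.card := fun w =>
    Finset.card_erase_eq_ite
  have hs : B.filter (fun w => (A.erase w).card = k) =
      (if A.card = k then B \ A else ∅) ∪ (if A.card = k + 1 then A else ∅) := by
    ext w
    simp only [mem_filter, e, mem_union]
    by_cases hw : w ∈ A
    · have : 0 < A.card := Finset.card_pos.2 ⟨w, hw⟩
      have hB := hAB hw
      by_cases h1 : A.card = k <;> by_cases h2 : A.card = k + 1 <;> simp [hw, h1, h2, hB] <;> omega
    · by_cases h1 : A.card = k <;> by_cases h2 : A.card = k + 1 <;> simp [hw, h1, h2]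
  rw [hs]
  have := Finset.card_le_card hAB
  by_cases h1 : A.card = k
  · have h2 : A.card ≠ k + 1 := by omega
    simp only [h1, if_true, if_neg (by omega : ¬ k = k + 1), Finset.union_empty,
      Finset.card_sdiff_of_subset hAB]
    omega
  · by_cases h2 : A.card = k + 1
    · simp [h2]
    · simp [h1, h2]

lemma Nn_sum (T : Finset ι) (k : ℕ) (u : E) :
    ∑ w ∈ univ \ T, C.Nn (insert w T) k u + (T.card + k) * C.Nn T k u
      = finrank ℝ E * C.Nn T k u + (k + 1) * C.Nn T (k + 1) u := by
  have hN : ∀ k, C.Nn T k u = ∑ S ∈ C.J.filter (fun S => T ⊆ S),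
      if (C.R S u \ T).card = k then 1 else 0 := by
    intro k
    rw [Nn, ← Finset.filter_filter, Finset.card_filter]
  have hS : ∑ w ∈ univ \ T, C.Nn (insert w T) k u = ∑ S ∈ C.J.filter (fun S => T ⊆ S),
      ((S \ T).filter (fun w => ((C.R S u \ T).erase w).card = k)).card := by
    simp_rw [Nn, Finset.card_filter]
    rw [Finset.sum_comm, Finset.sum_filter]
    apply Finset.sum_congr rfl
    intro S hS
    by_cases hT : T ⊆ S
    · rw [if_pos hT, ← Finset.sum_filter, ← Finset.sum_filter]
      simp only [Finset.sum_const]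
      congr 2
      ext w
      have : C.R S u \ insert w T = (C.R S u \ T).erase w := by
        ext i; simp only [mem_sdiff, mem_insert, mem_erase]; tauto
      simp only [mem_filter, mem_sdiff, mem_univ, true_and, this, Finset.insert_subset_iff]
      tauto
    · rw [if_neg hT]
      apply Finset.sum_eq_zero
      intro w _
      rw [if_neg]
      rintro ⟨h, -⟩
      exact hT ((Finset.subset_insert _ _).trans h)
  rw [hS, hN k, hN (k + 1), add_mul]
  simp only [Finset.mul_sum]
  rw [add_comm (∑ S ∈ _, T.card * _) _, ← add_assoc, ← Finset.sum_add_distrib, ← Finset.sum_add_distrib, ← Finset.sum_add_distrib]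
  apply Finset.sum_congr rfl
  intro S hS
  obtain ⟨hS, hT⟩ := Finset.mem_filter.1 hS
  rw [card_erase_count (Finset.sdiff_subset_sdiff (C.R_sub S u) Subset.rfl) k,
    Finset.card_sdiff_of_subset hT, C.card_J hS]
  have h3 := Finset.card_le_card hT
  rw [C.card_J hS] at h3
  obtain ⟨m, hm⟩ := Nat.exists_eq_add_of_le h3
  rw [hm, Nat.add_sub_cancel_left]
  ring

end Cfg
end Core

section Core

open Module

variable {E : Type*} [AddCommGroup E] [Module ℝ E] [FiniteDimensional ℝ E]
  {ι : Type*} [Fintype ι] [DecidableEq ι]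

namespace Cfg

variable (C : Cfg E ι)

lemma exists_gen : ∃ u, C.Gen u := by
  have := Module.Dual.exists_forall_ne_zero_of_forall_exists
    (fun q : (S : C.J) × S.1 => C.co q.1.1 q.2.1) (by
      rintro ⟨⟨S, hS⟩, ⟨i, hi⟩⟩
      exact ⟨C.x i, by simp [C.co_apply hS hi hi]⟩)
  obtain ⟨u, hu⟩ := this
  exact ⟨u, fun S hS i hi => hu ⟨⟨S, hS⟩, ⟨i, hi⟩⟩⟩

lemma exists_gen_inF : ∃ u, C.Gen u ∧ C.InF u := by
  obtain ⟨z, hz⟩ := C.exists_gen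
  have hzs : z ∈ Submodule.span ℝ (C.x '' (C.WF : Set ι)) := by
    have := C.spanF
    unfold Spans at this
    rw [WF, this]; trivial
  obtain ⟨c, hc⟩ : ∃ c : ι → ℝ, ∑ i ∈ C.WF, c i • C.x i = z := by
    obtain ⟨c, hc⟩ := (Submodule.mem_span_image_finset_iff_exists_fun ℝ).1 hzs
    refine ⟨fun i => if h : i ∈ C.WF then c ⟨i, h⟩ else 0, ?_⟩
    rw [← hc, ← Finset.sum_coe_sort C.WF]
    apply Finset.sum_congr rfl
    intro i _
    simp
  have hev : ∀ᶠ ε in nhdsWithin (0 : ℝ) (Set.Ioi 0), (∀ S ∈ C.J, ∀ i ∈ S,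
      C.co S i (∑ j ∈ C.WF, C.x j) + ε * C.co S i z ≠ 0) ∧ ∀ i ∈ C.WF, 0 < 1 + ε * c i := by
    apply Filter.Eventually.and
    · rw [Filter.eventually_all_finset]
      intro S hS
      rw [Filter.eventually_all_finset]
      intro i hi
      exact ev_ne _ _ (hz S hS i hi)
    · rw [Filter.eventually_all_finset]
      intro i hi
      exact ev_pos _
  obtain ⟨ε, h1, h2⟩ := hev.exists
  refine ⟨∑ j ∈ C.WF, C.x j + ε • z, ?_, ?_⟩
  · intro S hS i hi
    have := h1 S hS i hi
    simpa using this
  · intro b hb hne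
    have e : ∀ a : Dual ℝ E, a (∑ j ∈ C.WF, C.x j + ε • z)
        = ∑ j ∈ C.WF, (1 + ε * c j) * a (C.x j) := by
      intro a
      rw [← hc]
      simp only [map_add, map_sum, map_smul, smul_eq_mul, Finset.mul_sum, ← Finset.sum_add_distrib]
      apply Finset.sum_congr rfl
      intro j _
      ring
    rw [e, e]
    have haF : ∀ j ∈ C.WF, C.aF (C.x j) = 1 := fun j hj => mem_Wt.1 hj
    apply Finset.sum_lt_sum
    · intro j hj
      rw [haF j hj]
      exact mul_le_mul_of_nonneg_left (hb j) (h2 j hj).le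
    · by_contra hcon
      push Not at hcon
      apply hne
      apply eq_of_spans C.spanF
      intro j hj
      have := hcon j hj
      have := le_of_mul_le_mul_left this (h2 j hj)
      rw [haF j hj] at this ⊢
      exact le_antisymm (hb j) this

lemma choose_rec (N k : ℕ) : (k + 1) * (N + (k + 1) - 1).choose (k + 1)
    = (N + k) * (N + k - 1).choose k := by
  rcases Nat.eq_zero_or_pos (N + k) with h | h
  · obtain ⟨rfl, rfl⟩ : N = 0 ∧ k = 0 := by omega
    simp
  · obtain ⟨m, hm⟩ : ∃ m, N + k = m + 1 := ⟨N + k - 1, by omega⟩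
    have e1 : N + (k + 1) - 1 = m + 1 := by omega
    have e2 : N + k - 1 = m := by omega
    rw [e1, e2, hm, Nat.add_one_mul_choose_eq, mul_comm]

lemma link_bound {u : E} (hu : C.Gen u) {N : ℕ} (hN : Fintype.card ι = finrank ℝ E + N)
    {v : ι} (hv : v ∉ C.WF) (k : ℕ) : C.Nn {v} k u ≤ (N + k - 1).choose k := by
  have hT : ¬ ({v} : Finset ι) ⊆ C.WF := by simpa using hv
  induction k with
  | zero =>
    simp only [Nat.choose_zero_right]
    rw [Nn, Finset.card_le_one]
    intro S hS S' hS'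
    simp only [mem_filter, Finset.card_eq_zero, Finset.sdiff_eq_empty_iff_subset] at hS hS'
    exact C.part_unique hu hS.1 hS'.1 hS.2.2 hS.2.1 hS'.2.2 hS'.2.1
  | succ k ih =>
    have h1 := C.Nn_sum {v} k u
    have h2 : ∑ w ∈ univ \ {v}, C.Nn (insert w {v}) k u ≤ ∑ w ∈ (univ \ {v} : Finset ι), C.Nn {v} k u :=
      Finset.sum_le_sum fun w _ => C.Nn_mono hu {v} (Or.inl hT) k
    rw [Finset.sum_const, Finset.card_sdiff_of_subset (by simp), Finset.card_univ, hN, smul_eq_mul,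
      Finset.card_singleton] at h2
    rw [Finset.card_singleton] at h1
    have hpos : 1 ≤ finrank ℝ E + N := by rw [← hN]; exact Fintype.card_pos_iff.2 ⟨v⟩
    have h3 := choose_rec N k
    obtain ⟨m, hm⟩ := Nat.exists_eq_add_of_le hpos
    rw [hm, Nat.add_sub_cancel_left] at h2
    have h4 : (k + 1) * C.Nn {v} (k + 1) u ≤ (k + 1) * (N + (k + 1) - 1).choose (k + 1) := by
      rw [h3]
      have := Nat.mul_le_mul_left (N + k) ih
      nlinarith
    exact Nat.le_of_mul_le_mul_left h4 (by omega)

lemma H_bound {u : E} (hu : C.Gen u) (hF : C.InF u) {N s : ℕ}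
    (hN : Fintype.card ι = finrank ℝ E + N) (hs : C.WF.card = finrank ℝ E + s) (k : ℕ) :
    C.Nn ∅ k u + (s + k - 1).choose k ≤ (N + k - 1).choose k := by
  induction k with
  | zero =>
    simp only [Nat.choose_zero_right]
    have : C.Nn ∅ 0 u = 0 := by
      rw [Nn, Finset.card_eq_zero, Finset.filter_eq_empty_iff]
      rintro S hS ⟨-, h⟩
      apply C.R_not_sub hu hF hS
      simp only [Finset.sdiff_empty, Finset.card_eq_zero] at h
      rw [h]; simp
    omega
  | succ k ih =>
    have h1 := C.Nn_sum ∅ k u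
    simp only [Finset.sdiff_empty, Finset.card_empty, zero_add, insert_empty_eq] at h1
    rw [← Finset.sum_sdiff (Finset.subset_univ C.WF)] at h1
    have h2 : ∑ w ∈ C.WF, C.Nn {w} k u ≤ ∑ w ∈ C.WF, C.Nn ∅ k u :=
      Finset.sum_le_sum fun w hw => C.Nn_mono hu ∅ (Or.inr ⟨hF, hw⟩) k
    have h3 : ∑ w ∈ univ \ C.WF, C.Nn {w} k u ≤ ∑ w ∈ univ \ C.WF, (N + k - 1).choose k :=
      Finset.sum_le_sum fun w hw => C.link_bound hu hN (Finset.mem_sdiff.1 hw).2 k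
    rw [Finset.sum_const, smul_eq_mul, hs] at h2
    have hle := Finset.card_le_univ C.WF
    rw [Finset.sum_const, smul_eq_mul, Finset.card_sdiff_of_subset (Finset.subset_univ _),
      Finset.card_univ, hN, hs] at h3
    rw [hN, hs] at hle
    obtain ⟨m, rfl⟩ : ∃ m, N = s + m := ⟨N - s, by omega⟩
    have e : finrank ℝ E + (s + m) - (finrank ℝ E + s) = m := by omega
    rw [e] at h3
    have r1 := choose_rec (s + m) k
    have r2 := choose_rec s k
    have ih' := Nat.mul_le_mul_left (s + k) ih
    have : (k + 1) * (C.Nn ∅ (k + 1) u + (s + (k + 1) - 1).choose (k + 1))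
        ≤ (k + 1) * (s + m + (k + 1) - 1).choose (k + 1) := by
      rw [mul_add, r1, r2]
      nlinarith
    exact Nat.le_of_mul_le_mul_left this (by omega)

lemma R_neg {u : E} (hu : C.Gen u) {S : Finset ι} (hS : S ∈ C.J) :
    C.R S (-u) = S \ C.R S u := by
  ext i
  simp only [R, mem_filter, mem_sdiff, map_neg]
  constructor
  · rintro ⟨h1, h2⟩; exact ⟨h1, fun h => by linarith [h.2]⟩
  · rintro ⟨h1, h2⟩
    refine ⟨h1, ?_⟩
    have := hu S hS i h1
    have h3 : ¬ C.co S i u < 0 := fun h => h2 ⟨h1, h⟩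
    have := lt_of_le_of_ne (not_lt.1 h3) (Ne.symm this)
    linarith

lemma H_eq {u : E} (hu : C.Gen u) (hF : C.InF u) (k : ℕ) (hk : k ≤ finrank ℝ E) :
    (C.Nn ∅ (finrank ℝ E - k) u : ℤ) = ∑ i ∈ range (k + 1), (-1 : ℤ) ^ (k - i) *
      ((finrank ℝ E - i).choose (k - i) : ℤ) *
        (open Classical in (univ.filter (fun G => C.InD G ∧ G.card = i)).card : ℤ) := by
  classical
  have hneg : C.Gen (-u) := fun S hS i hi => by
    rw [map_neg]; exact neg_ne_zero.2 (hu S hS i hi)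
  have h := C.Nn_eq hneg ∅ (fun G => C.InD G) (by
    rintro G ⟨S, hS, hG⟩
    obtain ⟨a, ha, hs, hne, rfl⟩ := C.mem_J.1 hS
    refine ⟨Finset.empty_subset _, C.part_exists ha hs hG fun _ => ?_⟩
    simpa using hF a ha hne) (fun G S hS _ _ hG => ⟨S, hS, hG⟩) k (by simpa using hk)
  simp only [Finset.card_empty, zero_add, Nat.sub_zero] at h
  rw [← h]
  congr 1
  rw [Nn, Nn]
  congr 1
  apply Finset.filter_congr
  intro S hS
  simp only [Finset.empty_subset, true_and, Finset.sdiff_empty]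
  rw [C.R_neg hu hS, Finset.card_sdiff_of_subset (C.R_sub S u), C.card_J hS]
  have := Finset.card_le_card (C.R_sub S u)
  rw [C.card_J hS] at this
  omega

/-- faces other than `F` lie in the complex -/
lemma inD_of_val {a : Dual ℝ E} (ha : Val C.x a) (hne : a ≠ C.aF) : C.InD (Wt C.x a) := by
  obtain ⟨u, hu, hF⟩ := C.exists_gen_inF
  obtain ⟨a', hv, hsub, hsp, hle⟩ := exists_facet C.full ha (-u)
  refine ⟨Wt C.x a', C.mem_J.2 ⟨a', hv, hsp, ?_, rfl⟩, hsub⟩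
  rintro rfl
  have := hF a ha hne
  simp only [map_neg] at hle
  linarith

lemma exists_val_of_inD {G : Finset ι} (hG : C.InD G) : ∃ a, Val C.x a ∧ Wt C.x a = G := by
  obtain ⟨S, hS, hGS⟩ := hG
  obtain ⟨a, ha, -, -, haS⟩ := C.mem_J.1 hS
  let c : Dual ℝ E := -∑ i ∈ S \ G, C.co S i
  have hev : ∀ᶠ ε in nhdsWithin (0 : ℝ) (Set.Ioi 0), ∀ i ∈ univ \ S, a (C.x i) + ε * c (C.x i) < 1 := by
    rw [Filter.eventually_all_finset]
    intro i hi
    have h1 : a (C.x i) < 1 := lt_of_le_of_ne (ha i) fun h => by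
      rw [mem_sdiff, ← haS, mem_Wt] at hi
      exact hi.2 h
    apply Filter.Eventually.filter_mono nhdsWithin_le_nhds
    have : ContinuousAt (fun ε : ℝ => a (C.x i) + ε * c (C.x i)) 0 := by fun_prop
    exact this.eventually (gt_mem_nhds (by simpa using h1))
  obtain ⟨ε, h1, hpos⟩ := (hev.and self_mem_nhdsWithin).exists
  replace hpos : 0 < ε := hpos
  have hc : ∀ j ∈ S, c (C.x j) = if j ∈ G then 0 else -1 := by
    intro j hj
    simp only [c, LinearMap.neg_apply, LinearMap.sum_apply]
    rw [Finset.sum_congr rfl (fun i hi => C.co_apply hS (Finset.mem_sdiff.1 hi).1 hj),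
      Finset.sum_ite_eq']
    simp only [mem_sdiff, hj, true_and]
    split_ifs <;> simp_all
  have haS' : ∀ j ∈ S, a (C.x j) = 1 := fun j hj => mem_Wt.1 (haS.symm ▸ hj)
  have key : ∀ j, (a + ε • c) (C.x j) ≤ 1 ∧ ((a + ε • c) (C.x j) = 1 ↔ j ∈ G) := by
    intro j
    simp only [LinearMap.add_apply, LinearMap.smul_apply, smul_eq_mul]
    by_cases hj : j ∈ S
    · rw [hc j hj, haS' j hj]
      by_cases hjG : j ∈ G
      · simp [hjG]
      · simp only [hjG, if_false, iff_false]
        constructor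
        · linarith
        · intro h; linarith
    · have := h1 j (by simpa using hj)
      exact ⟨this.le, fun h => absurd h this.ne, fun h => absurd (hGS h) hj⟩
  refine ⟨a + ε • c, fun j => (key j).1, ?_⟩
  ext j
  rw [mem_Wt]
  exact (key j).2

lemma finrank_of_inD {G : Finset ι} (hG : C.InD G) :
    finrank ℝ (Submodule.span ℝ (C.x '' (G : Set ι))) = G.card := by
  obtain ⟨S, hS, hGS⟩ := hG
  have h1 : LinearIndependent ℝ (fun i : G => C.x i) :=
    (C.linInd_J hS).comp (fun i : G => (⟨i.1, hGS i.2⟩ : S)) (fun i j h => by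
      ext; simpa using congrArg Subtype.val h)
  have := finrank_span_eq_card h1
  rw [Fintype.card_coe] at this
  rw [← this]
  have e : C.x '' (G : Set ι) = Set.range (fun i : G => C.x i) := by ext y; simp
  rw [e]

lemma card_WF_lt (h : 0 < finrank ℝ E) : C.WF.card < Fintype.card ι := by
  have hne : C.aF ≠ 0 := by
    intro h0
    have : C.WF = ∅ := by
      ext i; simp [WF, mem_Wt, h0]
    have h2 := C.spanF
    rw [WF] at this
    rw [Spans, this] at h2
    simp only [coe_empty, Set.image_empty, Submodule.span_empty] at h2
    have := finrank_top ℝ E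
    rw [← h2, finrank_bot] at this
    omega
  obtain ⟨i, hi⟩ := C.full (-C.aF) (neg_ne_zero.2 hne)
  rw [← Finset.card_univ]
  apply Finset.card_lt_card
  rw [Finset.ssubset_univ_iff]
  intro h
  have : i ∈ C.WF := by rw [h]; simp
  rw [WF, mem_Wt] at this
  simp [this] at hi
  linarith

/-- combined core result -/
lemma main {N s : ℕ} (hN : Fintype.card ι = finrank ℝ E + N) (hs : C.WF.card = finrank ℝ E + s)
    (k : ℕ) (hk : k ≤ finrank ℝ E) :
    (∑ i ∈ range (finrank ℝ E - k + 1), (-1 : ℤ) ^ (finrank ℝ E - k - i) *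
      ((finrank ℝ E - i).choose (finrank ℝ E - k - i) : ℤ) *
        (open Classical in (univ.filter (fun G => C.InD G ∧ G.card = i)).card : ℤ))
      ≤ ((N + k - 1).choose k : ℤ) - ((s + k - 1).choose k : ℤ) := by
  obtain ⟨u, hu, hF⟩ := C.exists_gen_inF
  rw [← C.H_eq hu hF (finrank ℝ E - k) (by omega)]
  have := C.H_bound hu hF hN hs k
  have e : finrank ℝ E - (finrank ℝ E - k) = k := by omega
  rw [e]
  have h2 : (C.Nn ∅ k u : ℤ) + ((s + k - 1).choose k : ℤ) ≤ ((N + k - 1).choose k : ℤ) := by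
    exact_mod_cast this
  linarith

end Cfg
end Core

section Geo

open Module

variable {d : ℕ} {P : Set (Fin d → ℝ)}

lemma poly_compact (hP : IsPolytope P) : IsCompact P := by
  obtain ⟨V, rfl⟩ := hP
  exact V.finite_toSet.isCompact_convexHull ℝ

lemma poly_convex (hP : IsPolytope P) : Convex ℝ P := by
  obtain ⟨V, rfl⟩ := hP
  exact convex_convexHull ℝ _

lemma verts_finite (hP : IsPolytope P) : (verts P).Finite := by
  obtain ⟨V, rfl⟩ := hP
  exact V.finite_toSet.subset extremePoints_convexHull_subset

lemma hull_verts_of {Q : Set (Fin d → ℝ)} (hc : IsCompact Q) (hv : Convex ℝ Q)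
    (hf : (verts Q).Finite) : convexHull ℝ (verts Q) = Q := by
  have h := closure_convexHull_extremePoints hc hv
  have h2 := (hf.isClosed_convexHull ℝ).closure_eq
  exact h2.symm.trans h

lemma hull_verts (hP : IsPolytope P) : convexHull ℝ (verts P) = P :=
  hull_verts_of (poly_compact hP) (poly_convex hP) (verts_finite hP)

lemma interior_nonempty (hP : IsPolytope P) (hd : 0 < d) (hdim : polyDim P = d) :
    (interior P).Nonempty := by
  rw [(poly_convex hP).interior_nonempty_iff_affineSpan_eq_top]
  have hne : P.Nonempty := by
    by_contra h
    rw [Set.not_nonempty_iff_eq_empty] at h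
    subst h
    rw [polyDim, direction_affineSpan, vectorSpan_empty, finrank_bot] at hdim
    omega
  rw [← AffineSubspace.direction_eq_top_iff_of_nonempty ((affineSpan_nonempty ℝ).2 hne)]
  apply Submodule.eq_top_of_finrank_eq
  rw [Module.finrank_fin_fun]
  exact hdim

/-- linear functional of a vector -/
def toD (b : Fin d → ℝ) : Dual ℝ (Fin d → ℝ) where
  toFun := dotp b
  map_add' x y := by simp [dotp, mul_add, Finset.sum_add_distrib]
  map_smul' r x := by
    simp only [dotp, Finset.mul_sum, Pi.smul_apply, smul_eq_mul, RingHom.id_apply]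
    exact Finset.sum_congr rfl fun i _ => by ring

lemma toD_apply (b x : Fin d → ℝ) : toD b x = dotp b x := rfl

lemma toD_surj (a : Dual ℝ (Fin d → ℝ)) : ∃ b, toD b = a := by
  refine ⟨fun i => a (Pi.single i 1), ?_⟩
  refine LinearMap.pi_ext' fun i => LinearMap.ext_ring ?_
  change dotp _ (Pi.single i 1) = a (Pi.single i 1)
  simp [dotp, Pi.single_apply]

lemma toD_ne {b : Fin d → ℝ} (hb : b ≠ 0) : toD b ≠ 0 := by
  intro h
  apply hb
  ext i
  have : toD b (Pi.single i 1) = 0 := by rw [h]; rfl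
  rw [toD_apply] at this
  simpa [dotp, Pi.single_apply] using this

/-- translated vertices -/
def vx (P : Set (Fin d → ℝ)) (p : Fin d → ℝ) : verts P → (Fin d → ℝ) := fun i => i.1 - p

def Fs (P : Set (Fin d → ℝ)) (p : Fin d → ℝ) (a : Dual ℝ (Fin d → ℝ)) : Set (Fin d → ℝ) :=
  {z ∈ P | a (z - p) = 1}

variable [Fintype (verts P)] [DecidableEq (verts P)] {p : Fin d → ℝ}

lemma full_vx (hP : IsPolytope P) (hp : p ∈ interior P) : Full (vx P p) := by
  intro c hc
  by_contra hcon
  push Not at hcon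
  have hle : ∀ z ∈ P, c z ≤ c p := by
    intro z hz
    rw [← hull_verts hP] at hz
    have : convexHull ℝ (verts P) ⊆ {z | c z ≤ c p} := by
      apply convexHull_min
      · intro v hv
        have := hcon ⟨v, hv⟩
        simp only [vx, map_sub] at this
        simpa using this
      · exact convex_halfSpace_le c.isLinear _
    exact this hz
  obtain ⟨y, hy⟩ : ∃ y, 0 < c y := by
    obtain ⟨y, hy⟩ : ∃ y, c y ≠ 0 := by
      by_contra h
      push Not at h
      exact hc (LinearMap.ext h)
    rcases lt_or_gt_of_ne hy with h | h
    · exact ⟨-y, by simpa using h⟩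
    · exact ⟨y, h⟩
  have hcont : ContinuousAt (fun t : ℝ => p + t • y) 0 := by fun_prop
  have hev : ∀ᶠ t in nhds (0 : ℝ), p + t • y ∈ P := by
    apply hcont
    simp only [zero_smul, add_zero]
    exact mem_interior_iff_mem_nhds.1 hp
  have hev2 : ∀ᶠ t in nhdsWithin (0 : ℝ) (Set.Ioi 0), p + t • y ∈ P := hev.filter_mono nhdsWithin_le_nhds
  obtain ⟨t, ht, hpos⟩ := (hev2.and self_mem_nhdsWithin).exists
  replace hpos : 0 < t := hpos
  have := hle _ ht
  simp only [map_add, map_smul, smul_eq_mul] at this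
  nlinarith [mul_pos hpos hy]

lemma val_le (hP : IsPolytope P) {a : Dual ℝ (Fin d → ℝ)} (ha : Val (vx P p) a) :
    ∀ z ∈ P, a (z - p) ≤ 1 := by
  intro z hz
  rw [← hull_verts hP] at hz
  have : convexHull ℝ (verts P) ⊆ {z | a z ≤ 1 + a p} := by
    apply convexHull_min
    · intro v hv
      have := ha ⟨v, hv⟩
      simp only [vx, map_sub] at this
      simp only [Set.mem_setOf_eq]
      linarith
    · exact convex_halfSpace_le a.isLinear _
  have := this hz
  simp only [Set.mem_setOf_eq] at this
  rw [map_sub]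
  linarith

lemma face_rep (hP : IsPolytope P) (hp : p ∈ interior P) {G : Set (Fin d → ℝ)}
    (hG : IsFaceOf P G) (hne : G.Nonempty) (hGP : G ≠ P) :
    ∃ a, Val (vx P p) a ∧ G = Fs P p a := by
  rcases hG with h | h | ⟨b, c, hb, hle, rfl⟩
  · exact absurd h hne.ne_empty
  · exact absurd h hGP
  · obtain ⟨i, hi⟩ := full_vx hP hp _ (toD_ne hb)
    have hiP : i.1 ∈ P := extremePoints_subset i.2
    have h1 : 0 < c - toD b p := by
      have := hle _ hiP
      rw [← toD_apply] at this
      simp only [vx, map_sub] at hi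
      linarith
    refine ⟨(c - toD b p)⁻¹ • toD b, ?_, ?_⟩
    · intro j
      have := hle _ (extremePoints_subset j.2)
      rw [← toD_apply] at this
      simp only [vx, LinearMap.smul_apply, smul_eq_mul]
      rw [inv_mul_le_iff₀ h1, map_sub]
      linarith
    · ext z
      simp only [Fs, Set.mem_setOf_eq, LinearMap.smul_apply, smul_eq_mul, ← toD_apply]
      rw [inv_mul_eq_one₀ h1.ne', map_sub]
      constructor
      · rintro ⟨h1, h2⟩; exact ⟨h1, by linarith⟩
      · rintro ⟨h1, h2⟩; exact ⟨h1, by linarith⟩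

lemma face_of (hP : IsPolytope P) {a : Dual ℝ (Fin d → ℝ)} (ha : Val (vx P p) a) (h0 : a ≠ 0) :
    IsFaceOf P (Fs P p a) := by
  obtain ⟨b, rfl⟩ := toD_surj a
  refine Or.inr (Or.inr ⟨b, 1 + toD b p, ?_, ?_, ?_⟩)
  · rintro rfl
    apply h0
    refine LinearMap.ext fun z => ?_
    rw [toD_apply]
    simp [dotp]
  · intro z hz
    have := val_le hP ha z hz
    rw [map_sub] at this
    rw [← toD_apply]
    linarith
  · ext z
    simp only [Fs, Set.mem_setOf_eq, map_sub, ← toD_apply]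
    constructor
    · rintro ⟨h1, h2⟩; exact ⟨h1, by linarith⟩
    · rintro ⟨h1, h2⟩; exact ⟨h1, by linarith⟩

lemma Fs_extreme (hP : IsPolytope P) {a : Dual ℝ (Fin d → ℝ)} (ha : Val (vx P p) a) :
    IsExtreme ℝ P (Fs P p a) := by
  have key : ∀ x ∈ P, ∀ y ∈ P, ∀ z ∈ Fs P p a, z ∈ openSegment ℝ x y → x ∈ Fs P p a := by
    intro x hx y hy z hz hzs
    obtain ⟨s, t, hs, ht, hst, rfl⟩ := hzs
    have h1 := val_le hP ha x hx
    have h2 := val_le hP ha y hy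
    have h3 := hz.2
    refine ⟨hx, le_antisymm h1 ?_⟩
    simp only [map_sub, map_add, map_smul, smul_eq_mul] at h1 h2 h3 ⊢
    have ht' : t = 1 - s := by linarith
    subst ht'
    by_contra hcon
    push Not at hcon
    nlinarith
  constructor
  · exact fun z hz => hz.1
  · intro x hx y hy z hz hzs
    exact key x hx y hy z hz hzs

lemma verts_Fs (hP : IsPolytope P) {a : Dual ℝ (Fin d → ℝ)} (ha : Val (vx P p) a) :
    verts (Fs P p a) = Subtype.val '' (Wt (vx P p) a : Set (verts P)) := by
  rw [verts, (Fs_extreme hP ha).extremePoints_eq]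
  ext z
  simp only [Set.mem_inter_iff, Set.mem_image, Finset.mem_coe, mem_Wt]
  constructor
  · rintro ⟨h1, h2⟩
    exact ⟨⟨z, h2⟩, h1.2, rfl⟩
  · rintro ⟨i, hi, rfl⟩
    exact ⟨⟨extremePoints_subset i.2, hi⟩, i.2⟩

lemma hull_Fs (hP : IsPolytope P) {a : Dual ℝ (Fin d → ℝ)} (ha : Val (vx P p) a) :
    convexHull ℝ (Subtype.val '' (Wt (vx P p) a : Set (verts P))) = Fs P p a := by
  rw [← verts_Fs hP ha]
  have hcont : Continuous (fun z : Fin d → ℝ => a (z - p)) :=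
    a.continuous_of_finiteDimensional.comp (by fun_prop)
  apply hull_verts_of
  · exact (poly_compact hP).inter_right (isClosed_eq hcont continuous_const)
  · intro x hx y hy s t hs ht hst
    refine ⟨poly_convex hP hx.1 hy.1 hs ht hst, ?_⟩
    have h1 := hx.2
    have h2 := hy.2
    simp only [map_sub, map_add, map_smul, smul_eq_mul] at h1 h2 ⊢
    have ht' : t = 1 - s := by linarith
    subst ht'
    linear_combination s * h1 + (1 - s) * h2
  · rw [verts_Fs hP ha]
    exact (Finset.finite_toSet _).image _

lemma ncard_verts_Fs (hP : IsPolytope P) {a : Dual ℝ (Fin d → ℝ)} (ha : Val (vx P p) a) :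
    (verts (Fs P p a)).ncard = (Wt (vx P p) a).card := by
  rw [verts_Fs hP ha, Set.ncard_image_of_injective _ Subtype.val_injective, Set.ncard_coe_finset]

lemma Fs_nonempty (hP : IsPolytope P) {a : Dual ℝ (Fin d → ℝ)} (ha : Val (vx P p) a) :
    (Fs P p a).Nonempty ↔ (Wt (vx P p) a).Nonempty := by
  rw [← hull_Fs hP ha]
  simp

lemma polyDim_Fs (hP : IsPolytope P) {a : Dual ℝ (Fin d → ℝ)} (ha : Val (vx P p) a)
    (hne : (Wt (vx P p) a).Nonempty) :
    polyDim (Fs P p a) + 1 =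
      finrank ℝ (Submodule.span ℝ (vx P p '' (Wt (vx P p) a : Set (verts P)))) := by
  obtain ⟨q, hq⟩ := hne
  rw [← hull_Fs hP ha, polyDim, affineSpan_convexHull, direction_affineSpan]
  set s : Set (Fin d → ℝ) := Subtype.val '' (Wt (vx P p) a : Set (verts P)) with hs
  have hqs : q.1 ∈ s := ⟨q, hq, rfl⟩
  have hM := vectorSpan_eq_span_vsub_set_right ℝ hqs
  set M := vectorSpan ℝ s with hMdef
  have haM : ∀ y ∈ M, a y = 0 := by
    intro y hy
    rw [hM] at hy
    have : Submodule.span ℝ ((· -ᵥ q.1) '' s) ≤ LinearMap.ker a := by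
      rw [Submodule.span_le]
      rintro _ ⟨_, ⟨i, hi, rfl⟩, rfl⟩
      have h1 := mem_Wt.1 hi
      have h2 := mem_Wt.1 hq
      simp only [vx, map_sub] at h1 h2
      simp only [vsub_eq_sub, SetLike.mem_coe, LinearMap.mem_ker, map_sub]
      linarith
    exact this hy
  have hsup : Submodule.span ℝ (vx P p '' (Wt (vx P p) a : Set (verts P)))
      = M ⊔ Submodule.span ℝ {vx P p q} := by
    apply le_antisymm
    · rw [Submodule.span_le]
      rintro _ ⟨i, hi, rfl⟩
      have : vx P p i = (i.1 - q.1) + vx P p q := by simp [vx]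
      rw [this]
      apply Submodule.add_mem
      · apply Submodule.mem_sup_left
        rw [hM]
        exact Submodule.subset_span ⟨i.1, ⟨i, hi, rfl⟩, rfl⟩
      · exact Submodule.mem_sup_right (Submodule.mem_span_singleton_self _)
    · apply sup_le
      · rw [hM, Submodule.span_le]
        rintro _ ⟨_, ⟨i, hi, rfl⟩, rfl⟩
        have : i.1 -ᵥ q.1 = vx P p i - vx P p q := by simp [vx]
        change i.1 -ᵥ q.1 ∈ _
        rw [this]
        exact Submodule.sub_mem _ (Submodule.subset_span ⟨i, hi, rfl⟩)
          (Submodule.subset_span ⟨q, hq, rfl⟩)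
      · rw [Submodule.span_le, Set.singleton_subset_iff]
        exact Submodule.subset_span ⟨q, hq, rfl⟩
  have hq1 : a (vx P p q) = 1 := mem_Wt.1 hq
  have hq0 : vx P p q ≠ 0 := by
    intro h; rw [h] at hq1; simp at hq1
  have hinf : M ⊓ Submodule.span ℝ {vx P p q} = ⊥ := by
    rw [eq_bot_iff]
    rintro y ⟨hy1, hy2⟩
    obtain ⟨r, rfl⟩ := Submodule.mem_span_singleton.1 hy2
    have := haM _ hy1
    simp only [map_smul, hq1, smul_eq_mul, mul_one] at this
    simp [this]
  have := Submodule.finrank_sup_add_finrank_inf_eq M (Submodule.span ℝ {vx P p q})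
  rw [hinf, finrank_bot, finrank_span_singleton hq0] at this
  rw [hsup]
  omega

lemma spans_iff (S : Finset (verts P)) : Spans (vx P p) S ↔
    finrank ℝ (Submodule.span ℝ (vx P p '' (S : Set (verts P)))) = d := by
  constructor
  · intro h
    unfold Spans at h
    rw [h, finrank_top, Module.finrank_fin_fun]
  · intro h
    apply Submodule.eq_top_of_finrank_eq
    rw [h, Module.finrank_fin_fun]

lemma wt_nonempty (hd : 0 < d) {a : Dual ℝ (Fin d → ℝ)} (h : Spans (vx P p) (Wt (vx P p) a)) :
    (Wt (vx P p) a).Nonempty := by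
  by_contra hn
  rw [Finset.not_nonempty_iff_eq_empty] at hn
  rw [hn, spans_iff] at h
  rw [Finset.coe_empty, Set.image_empty, Submodule.span_empty, finrank_bot] at h
  omega

lemma exists_cfg (hd : 0 < d) {F : Set (Fin d → ℝ)} (hPF : IsASPPair P F) (hp : p ∈ interior P) :
    ∃ C : Cfg (Fin d → ℝ) (verts P), C.x = vx P p ∧ F = Fs P p C.aF := by
  obtain ⟨hP, hdim, ⟨hFf, hFn, hFd⟩, hsim⟩ := hPF
  obtain ⟨a, ha, hFa⟩ := face_rep hP hp hFf hFn (by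
    rintro rfl; omega)
  have hne : (Wt (vx P p) a).Nonempty := (Fs_nonempty hP ha).1 (hFa ▸ hFn)
  have hspan : Spans (vx P p) (Wt (vx P p) a) := by
    rw [spans_iff, ← polyDim_Fs hP ha hne, ← hFa, hFd]
    omega
  refine ⟨⟨vx P p, full_vx hP hp, a, ha, hspan, ?_⟩, rfl, hFa⟩
  intro b hb hbs hba
  have hbn := wt_nonempty hd hbs
  have hb0 : b ≠ 0 := by
    rintro rfl
    obtain ⟨i, hi⟩ := hbn
    simp [mem_Wt] at hi
  rw [Module.finrank_fin_fun, ← ncard_verts_Fs hP hb]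
  apply hsim
  · refine ⟨face_of hP hb hb0, (Fs_nonempty hP hb).2 hbn, ?_⟩
    have := polyDim_Fs hP hb hbn
    rw [(spans_iff _).1 hbs] at this
    omega
  · intro h
    apply hba
    have h1 : verts (Fs P p b) = verts (Fs P p a) := by rw [h, hFa]
    rw [verts_Fs hP hb, verts_Fs hP ha] at h1
    have h2 := Set.image_injective.2 Subtype.val_injective h1
    have h3 : Wt (vx P p) b = Wt (vx P p) a := by exact_mod_cast h2
    apply eq_of_spans hbs
    intro i hi
    rw [mem_Wt.1 hi, mem_Wt.1 (h3 ▸ hi)]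

open Classical in
lemma fVec_eq (hP : IsPolytope P) (hdim : polyDim P = d) (hp : p ∈ interior P)
    (C : Cfg (Fin d → ℝ) (verts P)) (hC : C.x = vx P p) (i : ℕ) (hi : 1 ≤ i) (hid : i < d) :
    fVec P (i - 1) = (univ.filter (fun G => C.InD G ∧ G.card = i)).card := by
  have hinj : Function.Injective (fun G : Finset (verts P) => (Subtype.val '' (G : Set (verts P)) : Set (Fin d → ℝ))) := by
    intro G G' h
    have h2 := Set.image_injective.2 Subtype.val_injective h
    exact_mod_cast h2
  have hset : {F : Set (Fin d → ℝ) | IsFaceOf P F ∧ F.Nonempty ∧ polyDim F = i - 1} =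
      (fun G : Finset (verts P) => convexHull ℝ (Subtype.val '' (G : Set (verts P)))) ''
        ((univ.filter (fun G => C.InD G ∧ G.card = i) : Finset (Finset (verts P))) : Set (Finset (verts P))) := by
    ext F
    simp only [Set.mem_setOf_eq, Set.mem_image, Finset.coe_filter, Finset.mem_univ, true_and]
    constructor
    · rintro ⟨hF, hn, hFd⟩
      obtain ⟨a, ha, rfl⟩ := face_rep hP hp hF hn (by rintro rfl; omega)
      have hne := (Fs_nonempty hP ha).1 hn
      have h1 := polyDim_Fs hP ha hne
      have hD : C.InD (Wt (vx P p) a) := by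
        rw [← hC]
        apply C.inD_of_val (hC ▸ ha)
        rintro rfl
        have := C.spanF
        rw [hC, spans_iff] at this
        omega
      refine ⟨_, ⟨hD, ?_⟩, hull_Fs hP ha⟩
      rw [← C.finrank_of_inD hD, hC]
      omega
    · rintro ⟨G, ⟨hD, hc⟩, rfl⟩
      obtain ⟨a, ha, hG⟩ := C.exists_val_of_inD hD
      have hfr := C.finrank_of_inD hD
      rw [hC] at ha hG hfr
      subst hG
      rw [hull_Fs hP ha]
      have hne : (Wt (vx P p) a).Nonempty := Finset.card_pos.1 (by omega)
      refine ⟨face_of hP ha ?_, (Fs_nonempty hP ha).2 hne, ?_⟩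
      · rintro rfl
        obtain ⟨j, hj⟩ := hne
        simp [mem_Wt] at hj
      · have := polyDim_Fs hP ha hne
        omega
  rw [fVec, hset, Set.ncard_image_of_injOn, Set.ncard_coe_finset]
  intro G hG G' hG' h
  simp only [Finset.coe_filter, Finset.mem_univ, true_and, Set.mem_setOf_eq] at hG hG'
  obtain ⟨a, ha, hGa⟩ := C.exists_val_of_inD hG.1
  obtain ⟨a', ha', hGa'⟩ := C.exists_val_of_inD hG'.1
  rw [hC] at ha hGa ha' hGa'
  subst hGa hGa'
  apply hinj
  simp only at h ⊢
  rw [hull_Fs hP ha, hull_Fs hP ha'] at h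
  rw [← verts_Fs hP ha, ← verts_Fs hP ha', h]

end Geo

/-- **UBT for ASP, upper h-range.** For an ASP-pair `(P,F)` with `P ∈ 𝒫(d,n,s)` and
`P' = ∂P − {F}`: `h_{d−k}(P') ≤ C(n−d−1+k, k) − C(s+k−1, k)` for every `1 ≤ k ≤ ⌊d/2⌋`. -/
theorem ubt_asp_upper_range (d n s : ℕ) (P F : Set (Fin d → ℝ)) (hPF : IsASPPair P F)
    (hn : (verts P).ncard = n) (hF : (verts F).ncard = d + s) :
    ∀ k : ℕ, 1 ≤ k → k ≤ d / 2 →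
      hBall P ((d : ℤ) - k)
        ≤ ((n - d - 1 + k).choose k : ℤ) - ((s + k - 1).choose k : ℤ) := by
  classical
  intro k hk1 hk2
  have hd : 0 < d := by omega
  have hP := hPF.1
  have hdim := hPF.2.1
  haveI : Fintype (verts P) := (verts_finite hP).fintype
  obtain ⟨p, hp⟩ := interior_nonempty hP hd hdim
  obtain ⟨C, hC, hFa⟩ := exists_cfg hd hPF hp
  have hfr : Module.finrank ℝ (Fin d → ℝ) = d := Module.finrank_fin_fun ℝ
  have hcard : Fintype.card (verts P) = n := by
    rw [← hn, ← Nat.card_eq_fintype_card, Nat.card_coe_set_eq]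
  have hWF : C.WF.card = d + s := by
    have hv := C.valF
    rw [hC] at hv
    rw [← hF, hFa, ncard_verts_Fs hP hv, Cfg.WF, hC]
  have hlt := C.card_WF_lt (by omega)
  rw [hWF, hcard] at hlt
  have hmain := C.main (N := n - d) (s := s) (by rw [hcard, hfr]; omega) (by rw [hfr, hWF]) k
    (by rw [hfr]; omega)
  rw [hfr] at hmain
  have e : n - d + k - 1 = n - d - 1 + k := by omega
  rw [e] at hmain
  refine le_trans (le_of_eq ?_) hmain
  have ht : ((d : ℤ) - k).toNat = d - k := by omega
  rw [hBall, if_pos (by omega), ht]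
  apply Finset.sum_congr rfl
  intro i hi
  have hi' : i ≤ d - k := by simpa [Nat.lt_succ_iff] using hi
  congr 1
  rw [fBall]
  by_cases h0 : i = 0
  · subst h0
    rw [if_pos rfl]
    have hD : C.InD ∅ := by
      have hv : Val C.x 0 := fun j => by simp
      have := C.inD_of_val hv (by
        intro h
        have h2 := C.spanF
        rw [← h, hC] at h2
        obtain ⟨j, hj⟩ := wt_nonempty hd h2
        simp [mem_Wt] at hj)
      have h3 : Wt C.x 0 = ∅ := by ext j; simp [mem_Wt]
      rwa [h3] at this
    have : (univ.filter (fun G => C.InD G ∧ G.card = 0)) = {∅} := by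
      ext G
      simp only [mem_filter, mem_univ, true_and, Finset.card_eq_zero, mem_singleton]
      exact ⟨fun h => h.2, fun h => ⟨h ▸ hD, h⟩⟩
    rw [this]; simp
  · rw [if_neg h0, if_neg (by omega), if_neg (by omega),
      fVec_eq hP hdim hp C hC i (by omega) (by omega)]

end

end ASP
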